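/- arXiv:2601.14717 — 2 statements merged into one kernel-verified Lean document; each statement's English description precedes it below -/
import Mathlib

section
/- Let f = h + conj(g) be a sense-preserving univalent harmonic self-mapping of the unit disk 𝔻 (so in addition f(𝔻) ⊆ 𝔻). Then for every r with 0 < r < 1, the area of the image of the disk of radius r satisfies m(f(r𝔻)) ≤ π r², where r𝔻 = {z ∈ ℂ : |z| < r}. -/
open MeasureTheory Metric Complex

section

open scoped Pointwise ENNReal

theorem volume_add_volume_le_of_isCompact {X Y : Set ℝ} (hX : IsCompact X) (hY : IsCompact Y)
    (hX0 : X.Nonempty) (hY0 : Y.Nonempty) : volume X + volume Y ≤ volume (X + Y) := by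
  obtain ⟨M, hM, hXM⟩ := hX.exists_isGreatest hX0
  obtain ⟨m, hm, hYm⟩ := hY.exists_isLeast hY0
  have hae : AEDisjoint volume (m +ᵥ X) (M +ᵥ Y) := by
    refine measure_mono_null (t := {m + M}) ?_ (by simp)
    rintro _ ⟨⟨x, hx, rfl⟩, ⟨y, hy, hxy⟩⟩
    have h1 := hXM hx
    have h2 := hYm hy
    simp only [vadd_eq_add, Set.mem_singleton_iff] at *
    linarith
  calc volume X + volume Y = volume (m +ᵥ X) + volume (M +ᵥ Y) := by
        rw [measure_vadd, measure_vadd]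
    _ = volume ((m +ᵥ X) ∪ (M +ᵥ Y)) :=
        (measure_union₀ (hY.measurableSet.const_vadd M).nullMeasurableSet hae).symm
    _ ≤ volume (X + Y) := by
        refine measure_mono (Set.union_subset ?_ ?_)
        · rintro _ ⟨x, hx, rfl⟩
          exact ⟨x, hx, m, hm, add_comm _ _⟩
        · rintro _ ⟨y, hy, rfl⟩
          exact ⟨M, hM, y, hy, rfl⟩

/-- The Brunn–Minkowski inequality on the real line. -/
theorem volume_add_volume_le {X Y : Set ℝ} (hX : MeasurableSet X) (hY : MeasurableSet Y)
    (hX0 : X.Nonempty) (hY0 : Y.Nonempty) : volume X + volume Y ≤ volume (X + Y) := by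
  obtain ⟨x, hx⟩ := hX0
  obtain ⟨y, hy⟩ := hY0
  rw [hX.measure_eq_iSup_isCompact, hY.measure_eq_iSup_isCompact]
  simp only [iSup_and']
  refine ENNReal.biSup_add_biSup_le' ⟨∅, by simp⟩ ⟨∅, by simp⟩ fun K ⟨hK, hKc⟩ L ⟨hL, hLc⟩ ↦ ?_
  calc volume K + volume L ≤ volume (insert x K) + volume (insert y L) := by
        gcongr <;> exact Set.subset_insert _ _
    _ ≤ volume (insert x K + insert y L) :=
        volume_add_volume_le_of_isCompact (hKc.insert x) (hLc.insert y) (by simp) (by simp)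
    _ ≤ volume (X + Y) := by
        gcongr
        · exact Set.insert_subset hx hK
        · exact Set.insert_subset hy hL

theorem volume_section_ne_top {A : Set (ℝ × ℝ)} (hA : IsCompact A) (x : ℝ) :
    volume (Prod.mk x ⁻¹' A) ≠ ∞ := by
  have hsub : Prod.mk x ⁻¹' A ⊆ Prod.snd '' A := fun y hy ↦ ⟨(x, y), hy, rfl⟩
  exact ((measure_mono hsub).trans_lt (hA.image continuous_snd).measure_lt_top).ne

theorem bddAbove_range_real_section {A : Set (ℝ × ℝ)} (hA : IsCompact A) :
    BddAbove (Set.range fun x ↦ volume.real (Prod.mk x ⁻¹' A)) := by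
  refine ⟨volume.real (Prod.snd '' A), ?_⟩
  rintro _ ⟨x, rfl⟩
  refine measureReal_mono (fun y hy ↦ ⟨_, hy, rfl⟩) ?_
  exact (hA.image continuous_snd).measure_lt_top.ne

theorem lintegral_ofReal_real_section_div {A : Set (ℝ × ℝ)} (hA : IsCompact A) {c : ℝ}
    (hc : 0 < c) :
    ∫⁻ s in Set.Ioi 0, volume {x | s < volume.real (Prod.mk x ⁻¹' A) / c} =
      ENNReal.ofReal (volume.real A / c) := by
  rw [← lintegral_eq_lintegral_meas_lt]
  · simp_rw [ENNReal.ofReal_div_of_pos hc, div_eq_mul_inv]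
    rw [lintegral_mul_const' _ _ (by simp [hc])]
    congr 1
    simp_rw [measureReal_def, ENNReal.ofReal_toReal (volume_section_ne_top hA _)]
    rw [ENNReal.ofReal_toReal hA.measure_lt_top.ne, Measure.volume_eq_prod,
      Measure.prod_apply hA.measurableSet]
  · exact .of_forall fun x ↦ by positivity
  · exact ((measurable_measure_prodMk_left hA.measurableSet).ennreal_toReal.div_const c).aemeasurable

/-- The Brunn–Minkowski inequality in the plane, for two compact sets of the same area. -/
theorem four_mul_volume_le_volume_add_prod {A B : Set (ℝ × ℝ)} (hA : IsCompact A)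
    (hB : IsCompact B) (hAB : volume A = volume B) : 4 * volume A ≤ volume (A + B) := by
  rcases eq_or_ne (volume A) 0 with h0 | h0
  · simp [h0]
  have hC : IsCompact (A + B) := hA.add hB
  set a : ℝ → ℝ := fun x ↦ volume.real (Prod.mk x ⁻¹' A) with ha
  set b : ℝ → ℝ := fun x ↦ volume.real (Prod.mk x ⁻¹' B) with hb
  set c : ℝ → ℝ := fun x ↦ volume.real (Prod.mk x ⁻¹' (A + B)) with hc
  have hsup : ∀ S : Set (ℝ × ℝ), IsCompact S → volume S ≠ 0 →
      0 < ⨆ x, volume.real (Prod.mk x ⁻¹' S) := by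
    intro S hS hS0
    by_contra! hle
    refine hS0 ?_
    rw [Measure.volume_eq_prod, Measure.measure_prod_null hS.measurableSet]
    refine .of_forall fun x ↦ ?_
    have h1 := (le_ciSup (bddAbove_range_real_section hS) x).trans hle
    exact (measureReal_eq_zero_iff (volume_section_ne_top hS x)).1 (le_antisymm h1 measureReal_nonneg)
  have hα := hsup A hA h0
  have hβ := hsup B hB (hAB ▸ h0)
  set α := ⨆ x, volume.real (Prod.mk x ⁻¹' A) with hαdef
  set β := ⨆ x, volume.real (Prod.mk x ⁻¹' B) with hβdef
  have hmeas : ∀ S : Set (ℝ × ℝ), IsCompact S → ∀ d s : ℝ,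
      MeasurableSet {x | s < volume.real (Prod.mk x ⁻¹' S) / d} := fun S hS d s ↦
    measurableSet_lt measurable_const
      ((measurable_measure_prodMk_left hS.measurableSet).ennreal_toReal.div_const d)
  have hlevel : ∀ s ∈ Set.Ioi (0 : ℝ), volume {x | s < a x / α} + volume {x | s < b x / β} ≤
      volume {x | s < c x / (α + β)} := by
    intro s hs
    rcases le_or_gt 1 s with h1 | h1
    · have e1 : {x | s < a x / α} = ∅ := by
        ext x
        simpa using ((div_le_one hα).2 (le_ciSup (bddAbove_range_real_section hA) x)).trans h1
      have e2 : {x | s < b x / β} = ∅ := by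
        ext x
        simpa using ((div_le_one hβ).2 (le_ciSup (bddAbove_range_real_section hB) x)).trans h1
      simp [e1, e2]
    · refine (volume_add_volume_le (hmeas A hA α s) (hmeas B hB β s) ?_ ?_).trans (measure_mono ?_)
      · obtain ⟨x, hx⟩ := exists_lt_of_lt_ciSup (show s * α < α by nlinarith)
        exact ⟨x, (lt_div_iff₀ hα).2 hx⟩
      · obtain ⟨x, hx⟩ := exists_lt_of_lt_ciSup (show s * β < β by nlinarith)
        exact ⟨x, (lt_div_iff₀ hβ).2 hx⟩
      · rintro _ ⟨x, hx, y, hy, rfl⟩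
        have hx' : s * α < a x := (lt_div_iff₀ hα).1 hx
        have hy' : s * β < b y := (lt_div_iff₀ hβ).1 hy
        have hs0 : 0 < s := hs
        have hne : ∀ S : Set ℝ, 0 < volume.real S → S.Nonempty := fun S hS ↦
          Set.nonempty_iff_ne_empty.2 fun h ↦ by simp [h] at hS
        have key : a x + b y ≤ c (x + y) := by
          have h2 := volume_add_volume_le (measurable_prodMk_left (x := x) hA.measurableSet)
            (measurable_prodMk_left (x := y) hB.measurableSet)
            (hne _ (lt_trans (by positivity) hx')) (hne _ (lt_trans (by positivity) hy'))
          rw [ha, hb, hc]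
          simp only [measureReal_def]
          rw [← ENNReal.toReal_add (volume_section_ne_top hA x) (volume_section_ne_top hB y)]
          refine ENNReal.toReal_mono (volume_section_ne_top hC _) (h2.trans (measure_mono ?_))
          rintro _ ⟨u, hu, v, hv, rfl⟩
          exact ⟨_, hu, _, hv, rfl⟩
        show s < c (x + y) / (α + β)
        rw [lt_div_iff₀ (by positivity)]
        linarith
  have hint := setLIntegral_mono' (μ := volume) measurableSet_Ioi hlevel
  rw [lintegral_add_left', lintegral_ofReal_real_section_div hA hα,
    lintegral_ofReal_real_section_div hB hβ,
    lintegral_ofReal_real_section_div hC (add_pos hα hβ),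
    ← ENNReal.ofReal_add (by positivity) (by positivity),
    ENNReal.ofReal_le_ofReal_iff (by positivity)] at hint
  · have hM : volume.real B = volume.real A := by simp [measureReal_def, hAB]
    rw [hM] at hint
    have hMnn : 0 ≤ volume.real A := measureReal_nonneg
    have hfinal : 4 * volume.real A ≤ volume.real (A + B) := by
      rw [div_add_div _ _ hα.ne' hβ.ne', div_le_div_iff₀ (by positivity) (by positivity)] at hint
      have : 4 * volume.real A * (α * β) ≤ volume.real (A + B) * (α * β) := by
        nlinarith [mul_nonneg hMnn (sq_nonneg (α - β))]
      exact le_of_mul_le_mul_right this (by positivity)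
    rw [← ENNReal.ofReal_toReal hA.measure_lt_top.ne, ← ENNReal.ofReal_toReal hC.measure_lt_top.ne,
      ← ENNReal.ofReal_ofNat 4, ← ENNReal.ofReal_mul (by norm_num)]
    exact ENNReal.ofReal_le_ofReal hfinal
  · have : Antitone fun s : ℝ ↦ volume {x | s < a x / α} := fun s t hst ↦
      measure_mono fun x hx ↦ lt_of_le_of_lt hst hx
    exact this.measurable.aemeasurable

/-- The Brunn–Minkowski inequality for two compact subsets of `ℂ` of the same area. -/
theorem four_mul_volume_le_volume_add {A B : Set ℂ} (hA : IsCompact A) (hB : IsCompact B)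
    (hAB : volume A = volume B) : 4 * volume A ≤ volume (A + B) := by
  have hvol : ∀ S : Set ℂ, volume (equivRealProdCLM '' S) = volume S := by
    intro S
    have h := volume_preserving_equiv_real_prod.symm.measure_preimage_equiv S
    rw [← h]
    congr 1
    ext p
    constructor
    · rintro ⟨z, hz, rfl⟩
      simpa using hz
    · intro hp
      exact ⟨_, hp, by simp⟩
  have h := four_mul_volume_le_volume_add_prod (hA.image equivRealProdCLM.continuous)
    (hB.image equivRealProdCLM.continuous) (by rw [hvol, hvol, hAB])
  rwa [← Set.image_add equivRealProdCLM, hvol, hvol] at h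

theorem continuousOn_poissonKernel_sphere {z : ℂ} (hz : ‖z‖ < 1) :
    ContinuousOn (poissonKernel 0 z) (sphere 0 1) := by
  unfold poissonKernel
  refine ContinuousOn.div (by fun_prop) (by fun_prop) fun ζ hζ ↦ ?_
  have : ζ ≠ z := by
    rintro rfl
    simp at hζ
    linarith
  simpa [sub_eq_zero] using this

theorem circleIntegrable_poissonKernel_mul {F : ℂ → ℝ} (hF : ContinuousOn F (sphere 0 1)) {z : ℂ}
    (hz : ‖z‖ < 1) : CircleIntegrable (fun ζ ↦ poissonKernel 0 z ζ * F ζ) 0 1 :=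
  ((continuousOn_poissonKernel_sphere hz).mul hF).circleIntegrable zero_le_one

theorem circleAverage_poissonKernel_mul_re {F : ℂ → ℂ} (hF : DiffContOnCl ℂ F (ball 0 1)) {z : ℂ}
    (hz : ‖z‖ < 1) : Real.circleAverage (fun ζ ↦ poissonKernel 0 z ζ * (F ζ).re) 0 1 = (F z).re := by
  have hz' : z ∈ ball (0 : ℂ) 1 := by simpa using hz
  have hcont : ContinuousOn F (sphere 0 1) :=
    hF.continuousOn.mono (by rw [closure_ball _ one_ne_zero]; exact sphere_subset_closedBall)
  have hint : CircleIntegrable (poissonKernel 0 z • F) 0 1 :=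
    ((continuousOn_poissonKernel_sphere hz).smul hcont).circleIntegrable zero_le_one
  have h := Complex.reCLM.circleAverage_comp_comm hint
  rw [hF.circleAverage_poissonKernel_smul hz', Complex.reCLM_apply] at h
  rw [← h]
  congr 1
  ext ζ
  simp

/-- Rearrangement-type estimate for the Poisson kernel, obtained from `log x ≤ x - 1`. -/
theorem poissonKernel_mul_re_le {q : ℝ} (hq0 : 0 < q) (hq1 : q < 1) {z ζ v : ℂ} (hz : ‖z‖ = q)
    (hζ : ‖ζ‖ = 1) (hv : ‖v‖ ≤ 1) :
    poissonKernel 0 z ζ * v.re ≤ (1 + q ^ 2) / (2 * q) * poissonKernel 0 z ζ -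
      (1 - q ^ 2) / (2 * q) + (1 - q ^ 2) / q * (Real.log ‖ζ - z‖ - Real.log ‖1 - q * v‖) := by
  have hD : 0 < ‖ζ - z‖ := by
    rw [norm_pos_iff, sub_ne_zero]
    rintro rfl
    linarith
  have hE : 0 < ‖1 - q * v‖ := by
    rw [norm_pos_iff, sub_ne_zero]
    intro h
    have h1 := congrArg norm h
    rw [norm_one, norm_mul, Complex.norm_real, Real.norm_of_nonneg hq0.le] at h1
    nlinarith
  have hq2 : 0 < 1 - q ^ 2 := by nlinarith
  have hre : v.re ≤ (1 + q ^ 2 - ‖1 - q * v‖ ^ 2) / (2 * q) := by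
    rw [le_div_iff₀ (by positivity)]
    have h1 : ‖1 - q * v‖ ^ 2 = 1 - 2 * q * v.re + q ^ 2 * ‖v‖ ^ 2 := by
      rw [← normSq_eq_norm_sq, ← normSq_eq_norm_sq, normSq_apply, normSq_apply]
      simp
      ring
    have h2 : ‖v‖ ^ 2 ≤ 1 := by
      rw [sq_le_one_iff₀ (norm_nonneg _)]
      exact hv
    nlinarith [mul_le_mul_of_nonneg_left h2 (sq_nonneg q)]
  have hP : poissonKernel 0 z ζ = (1 - q ^ 2) / ‖ζ - z‖ ^ 2 := by
    simp [poissonKernel_def, hz, hζ]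
  have hlog := Real.log_le_sub_one_of_pos (x := ‖1 - q * v‖ ^ 2 / ‖ζ - z‖ ^ 2) (by positivity)
  rw [Real.log_div (by positivity) (by positivity), Real.log_pow, Real.log_pow] at hlog
  push_cast at hlog
  calc poissonKernel 0 z ζ * v.re
      ≤ poissonKernel 0 z ζ * ((1 + q ^ 2 - ‖1 - q * v‖ ^ 2) / (2 * q)) := by
        refine mul_le_mul_of_nonneg_left hre ?_
        rw [hP]
        positivity
    _ = (1 + q ^ 2) / (2 * q) * poissonKernel 0 z ζ -
          (1 - q ^ 2) / (2 * q) * (‖1 - q * v‖ ^ 2 / ‖ζ - z‖ ^ 2) := by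
        rw [hP]
        field_simp
    _ ≤ (1 + q ^ 2) / (2 * q) * poissonKernel 0 z ζ - (1 - q ^ 2) / (2 * q) *
          (1 + 2 * Real.log ‖1 - q * v‖ - 2 * Real.log ‖ζ - z‖) := by
        have : 0 < (1 - q ^ 2) / (2 * q) := by positivity
        gcongr
        linarith
    _ = _ := by
        field_simp
        ring

/-- If the rotations `ω i` are equidistributed in the sense that `∏ (1 - ω i * v)` is at least
`1 - q ^ N` in norm for `‖v‖ ≤ q`, then the rotated values of a harmonic function bounded by one,
taken at points of modulus `q`, have a sum of real part at most `N * q` up to a logarithmic error. -/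
theorem sum_re_mul_harmonic_le {ι : Type} [Fintype ι] {h g : ℂ → ℂ}
    (hh : DiffContOnCl ℂ h (ball 0 1)) (hg : DiffContOnCl ℂ g (ball 0 1))
    (hfb : ∀ ζ ∈ sphere (0 : ℂ) 1, ‖h ζ + (starRingEnd ℂ) (g ζ)‖ ≤ 1)
    {q : ℝ} (hq0 : 0 < q) (hq1 : q < 1) {ω z : ι → ℂ} (hω : ∀ i, ‖ω i‖ = 1)
    (hz : ∀ i, ‖z i‖ = q) {N : ℕ} (hN : N ≠ 0)
    (hprod : ∀ v : ℂ, ‖v‖ ≤ q → 1 - q ^ N ≤ ‖∏ i, (1 - ω i * v)‖) :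
    ∑ i, (ω i * (h (z i) + (starRingEnd ℂ) (g (z i)))).re ≤
      Fintype.card ι * q - (1 - q ^ 2) / q * Real.log (1 - q ^ N) := by
  set F : ι → ℂ → ℂ := fun i ζ ↦ ω i * h ζ + (starRingEnd ℂ) (ω i) * g ζ with hF
  have hFre : ∀ i ζ, (ω i * (h ζ + (starRingEnd ℂ) (g ζ))).re = (F i ζ).re := by
    intro i ζ
    simp [hF]
    ring
  have hFd : ∀ i, DiffContOnCl ℂ (F i) (ball 0 1) := fun i ↦
    (hh.const_smul (ω i)).add (hg.const_smul ((starRingEnd ℂ) (ω i)))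
  have hFc : ∀ i, ContinuousOn (fun ζ ↦ (F i ζ).re) (sphere 0 1) := fun i ↦
    continuous_re.comp_continuousOn ((hFd i).continuousOn.mono
      (by rw [closure_ball _ one_ne_zero]; exact sphere_subset_closedBall))
  have hz1 : ∀ i, ‖z i‖ < 1 := fun i ↦ by rw [hz]; exact hq1
  have hqN : q ^ N < 1 := pow_lt_one₀ hq0.le hq1 hN
  have hc : 0 < (1 - q ^ 2) / q := div_pos (by nlinarith) hq0
  have hP : ∀ i, CircleIntegrable (poissonKernel 0 (z i)) 0 1 := fun i ↦ by
    simpa using circleIntegrable_poissonKernel_mul (F := fun _ ↦ 1) continuousOn_const (hz1 i)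
  have hPavg : ∀ i, Real.circleAverage (poissonKernel 0 (z i)) 0 1 = 1 := fun i ↦ by
    simpa using circleAverage_poissonKernel_mul_re (F := fun _ ↦ 1) diffContOnCl_const (hz1 i)
  have hL : ∀ i, CircleIntegrable (fun ζ ↦ Real.log ‖ζ - z i‖) 0 1 := fun i ↦
    circleIntegrable_log_norm_sub_const 1
  set G : ι → ℂ → ℝ := fun i ↦ ((1 + q ^ 2) / (2 * q)) • poissonKernel 0 (z i) +
    ((1 - q ^ 2) / q) • (fun ζ ↦ Real.log ‖ζ - z i‖) with hG
  have hGint : ∀ i, CircleIntegrable (G i) 0 1 := fun i ↦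
    ((hP i).const_smul).add (hL i).const_smul
  have hGavg : ∀ i, Real.circleAverage (G i) 0 1 = (1 + q ^ 2) / (2 * q) := fun i ↦ by
    rw [hG, Real.circleAverage_add (hP i).const_smul (hL i).const_smul,
      Real.circleAverage_smul, Real.circleAverage_smul, hPavg,
      circleAverage_log_norm_sub_const₀ (hz1 i)]
    simp
  set K : ℝ := -(Fintype.card ι * ((1 - q ^ 2) / (2 * q))) -
    (1 - q ^ 2) / q * Real.log (1 - q ^ N) with hK
  have hpt : ∀ ζ ∈ sphere (0 : ℂ) |1|,
      (∑ i, fun ζ ↦ poissonKernel 0 (z i) ζ * (F i ζ).re) ζ ≤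
        (((∑ i, G i) + fun _ ↦ K : ℂ → ℝ)) ζ := by
    intro ζ hζ
    rw [abs_one] at hζ
    have hζ1 : ‖ζ‖ = 1 := by simpa using hζ
    set w := h ζ + (starRingEnd ℂ) (g ζ) with hw
    have hw1 : ‖w‖ ≤ 1 := hfb ζ hζ
    have hne : ∀ i, 1 - ω i * (q * w) ≠ 0 := fun i h0 ↦ by
      have h1 := congrArg norm (sub_eq_zero.1 h0)
      rw [norm_one, norm_mul, hω, norm_mul, Complex.norm_real, Real.norm_of_nonneg hq0.le] at h1
      nlinarith
    have h1 : ∀ i ∈ Finset.univ, poissonKernel 0 (z i) ζ * (F i ζ).re ≤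
        G i ζ - (1 - q ^ 2) / (2 * q) - (1 - q ^ 2) / q * Real.log ‖1 - ω i * (q * w)‖ := by
      intro i _
      have h2 := poissonKernel_mul_re_le hq0 hq1 (hz i) hζ1 (v := ω i * w)
        (by rw [norm_mul, hω, one_mul]; exact hw1)
      rw [hFre i ζ] at h2
      refine h2.trans_eq ?_
      rw [show (q : ℂ) * (ω i * w) = ω i * (q * w) by ring]
      simp only [hG, Pi.add_apply, Pi.smul_apply, smul_eq_mul]
      ring
    have h3 : Real.log (1 - q ^ N) ≤ ∑ i, Real.log ‖1 - ω i * (q * w)‖ := by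
      rw [← Real.log_prod (fun i _ ↦ norm_ne_zero_iff.2 (hne i)), ← norm_prod]
      refine Real.log_le_log (by linarith) (hprod _ ?_)
      rw [norm_mul, Complex.norm_real, Real.norm_of_nonneg hq0.le]
      nlinarith
    have h4 := Finset.sum_le_sum h1
    rw [Finset.sum_sub_distrib, Finset.sum_sub_distrib, ← Finset.mul_sum] at h4
    simp only [Finset.sum_const, Finset.card_univ, nsmul_eq_mul] at h4
    simp only [Finset.sum_apply, Pi.add_apply, hK]
    have h5 := mul_le_mul_of_nonneg_left h3 hc.le
    linarith
  have hmono := Real.circleAverage_mono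
    (CircleIntegrable.sum Finset.univ
      fun i _ ↦ circleIntegrable_poissonKernel_mul (hFc i) (hz1 i))
    ((CircleIntegrable.sum Finset.univ fun i _ ↦ hGint i).add
      (circleIntegrable_const K 0 1)) hpt
  rw [Real.circleAverage_sum fun i _ ↦ circleIntegrable_poissonKernel_mul (hFc i) (hz1 i),
    Real.circleAverage_add (CircleIntegrable.sum Finset.univ fun i _ ↦ hGint i)
      (circleIntegrable_const K 0 1), Real.circleAverage_sum fun i _ ↦ hGint i,
    Real.circleAverage_const] at hmono
  simp only [hGavg, Finset.sum_const, Finset.card_univ, nsmul_eq_mul] at hmono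
  simp_rw [hFre]
  calc ∑ i, (F i (z i)).re
      = ∑ i, Real.circleAverage (fun ζ ↦ poissonKernel 0 (z i) ζ * (F i ζ).re) 0 1 :=
        Finset.sum_congr rfl fun i _ ↦ (circleAverage_poissonKernel_mul_re (hFd i) (hz1 i)).symm
    _ ≤ _ := hmono
    _ = _ := by
        rw [hK]
        field_simp
        ring

theorem volume_smul_of_norm_eq_one {c : ℂ} (hc : ‖c‖ = 1) (S : Set ℂ) :
    volume (c • S) = volume S := by
  have hc0 : c ≠ 0 := norm_ne_zero_iff.1 (by rw [hc]; exact one_ne_zero)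
  let a : Circle := ⟨c, mem_sphere_zero_iff_norm.2 hc⟩
  rw [← (rotation a).measurePreserving.measure_preimage_emb
    (rotation a).toHomeomorph.measurableEmbedding (c • S)]
  congr 1
  ext x
  exact (Set.smul_mem_smul_set_iff₀ hc0 S x)

theorem exists_norm_eq_one_pow_eq_neg_one {N : ℕ} (hN : N ≠ 0) :
    ∃ c : ℂ, ‖c‖ = 1 ∧ c ^ N = -1 := by
  obtain ⟨c, hc⟩ := IsAlgClosed.exists_pow_nat_eq (-1 : ℂ) (Nat.pos_of_ne_zero hN)
  refine ⟨c, (pow_eq_one_iff_of_nonneg (norm_nonneg c) hN).1 ?_, hc⟩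
  rw [← norm_pow, hc, norm_neg, norm_one]

/-- Iterating the Brunn–Minkowski inequality along rotations by roots of unity. -/
theorem exists_isCompact_sum_rotations {K : Set ℂ} (hK : IsCompact K) (k : ℕ) :
    ∃ S : Set ℂ, IsCompact S ∧ 4 ^ k * volume K ≤ volume S ∧
      ∀ y ∈ S, ∃ (ι : Type) (_ : Fintype ι) (ω x : ι → ℂ), Fintype.card ι = 2 ^ k ∧
        (∀ i, ‖ω i‖ = 1) ∧ (∀ i, x i ∈ K) ∧ y = ∑ i, ω i * x i ∧
        ∀ v, ∏ i, (1 - ω i * v) = 1 - v ^ 2 ^ k := by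
  induction k with
  | zero =>
    refine ⟨K, hK, by simp, fun y hy ↦ ⟨Unit, inferInstance, fun _ ↦ 1, fun _ ↦ y, ?_⟩⟩
    simpa using hy
  | succ k ih =>
    obtain ⟨S, hS, hvol, hrep⟩ := ih
    obtain ⟨c, hc, hcN⟩ := exists_norm_eq_one_pow_eq_neg_one (N := 2 ^ k) (by positivity)
    refine ⟨S + c • S, hS.add (hS.smul c), ?_, ?_⟩
    · calc 4 ^ (k + 1) * volume K = 4 * (4 ^ k * volume K) := by rw [pow_succ']; ring
        _ ≤ 4 * volume S := by gcongr
        _ ≤ volume (S + c • S) :=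
          four_mul_volume_le_volume_add hS (hS.smul c) (volume_smul_of_norm_eq_one hc S).symm
    · rintro _ ⟨y, hy, _, ⟨y', hy', rfl⟩, rfl⟩
      obtain ⟨ι, _, ω, x, hcard, hω, hx, rfl, hprod⟩ := hrep y hy
      obtain ⟨ι', _, ω', x', hcard', hω', hx', rfl, hprod'⟩ := hrep y' hy'
      refine ⟨ι ⊕ ι', inferInstance, Sum.elim ω fun i ↦ c * ω' i, Sum.elim x x', ?_, ?_, ?_, ?_,
        fun v ↦ ?_⟩
      · rw [Fintype.card_sum, hcard, hcard', pow_succ]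
        ring
      · rintro (i | i)
        · exact hω i
        · simp [hc, hω']
      · rintro (i | i)
        · exact hx i
        · exact hx' i
      · simp [Finset.mul_sum, mul_assoc]
      · have h1 : ∀ i, 1 - c * ω' i * v = 1 - ω' i * (c * v) := fun i ↦ by ring
        simp only [Fintype.prod_sum_type, Sum.elim_inl, Sum.elim_inr, h1, hprod, hprod']
        rw [mul_pow, hcN, pow_succ, pow_mul]
        ring

/-- The maximum principle for the real part of a rotated harmonic function. -/
theorem exists_norm_eq_re_mul_harmonic_le {h g : ℂ → ℂ} (hh : DiffContOnCl ℂ h (ball 0 1))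
    (hg : DiffContOnCl ℂ g (ball 0 1)) {q : ℝ} (hq0 : 0 < q) (hq1 : q < 1) (ω : ℂ) {z : ℂ}
    (hz : ‖z‖ ≤ q) :
    ∃ z' : ℂ, ‖z'‖ = q ∧ (ω * (h z + (starRingEnd ℂ) (g z))).re ≤
      (ω * (h z' + (starRingEnd ℂ) (g z'))).re := by
  set F : ℂ → ℂ := fun ζ ↦ ω * h ζ + (starRingEnd ℂ) ω * g ζ with hF
  have hFre : ∀ ζ, (ω * (h ζ + (starRingEnd ℂ) (g ζ))).re = (F ζ).re := by
    intro ζ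
    simp [hF]
    ring
  have hFd : DiffContOnCl ℂ F (ball 0 q) :=
    ((hh.const_smul ω).add (hg.const_smul ((starRingEnd ℂ) ω))).mono (ball_subset_ball hq1.le)
  obtain ⟨z', hz', hmax⟩ := exists_mem_frontier_isMaxOn_norm isBounded_ball
    (nonempty_ball.2 hq0) (Complex.differentiable_exp.comp_diffContOnCl hFd)
  rw [frontier_ball _ hq0.ne', mem_sphere_zero_iff_norm] at hz'
  rw [closure_ball _ hq0.ne'] at hmax
  refine ⟨z', hz', ?_⟩
  have h1 := hmax (mem_closedBall_zero_iff.2 hz)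
  simp only [Set.mem_ofPred_eq, Function.comp_apply, Complex.norm_exp, Real.exp_le_exp] at h1
  rwa [hFre, hFre]

theorem norm_sum_mul_harmonic_le {h g : ℂ → ℂ} (hh : DiffContOnCl ℂ h (ball 0 1))
    (hg : DiffContOnCl ℂ g (ball 0 1))
    (hfb : ∀ ζ ∈ sphere (0 : ℂ) 1, ‖h ζ + (starRingEnd ℂ) (g ζ)‖ ≤ 1)
    {q : ℝ} (hq0 : 0 < q) (hq1 : q < 1) {ι : Type} [Fintype ι] {ω x : ι → ℂ}
    (hω : ∀ i, ‖ω i‖ = 1)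
    (hx : ∀ i, x i ∈ (fun z ↦ h z + (starRingEnd ℂ) (g z)) '' closedBall 0 q) {N : ℕ}
    (hN : N ≠ 0) (hprod : ∀ v, ∏ i, (1 - ω i * v) = 1 - v ^ N) :
    ‖∑ i, ω i * x i‖ ≤ Fintype.card ι * q - (1 - q ^ 2) / q * Real.log (1 - q ^ N) := by
  obtain ⟨c, hc, hcy⟩ := Complex.exists_norm_eq_mul_self (∑ i, ω i * x i)
  have hchoose : ∀ i, ∃ z : ℂ, ‖z‖ = q ∧
      (c * ω i * x i).re ≤ (c * ω i * (h z + (starRingEnd ℂ) (g z))).re := by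
    intro i
    obtain ⟨z, hz, hzx⟩ := hx i
    rw [← hzx]
    exact exists_norm_eq_re_mul_harmonic_le hh hg hq0 hq1 _ (mem_closedBall_zero_iff.1 hz)
  choose z hz hzx using hchoose
  have hre : ‖∑ i, ω i * x i‖ = ∑ i, (c * ω i * x i).re := by
    rw [← Complex.re_sum, ← Complex.ofReal_re ‖∑ i, ω i * x i‖, hcy, Finset.mul_sum]
    simp_rw [mul_assoc]
  rw [hre]
  refine (Finset.sum_le_sum fun i _ ↦ hzx i).trans ?_
  refine sum_re_mul_harmonic_le hh hg hfb hq0 hq1 (fun i ↦ by rw [norm_mul, hc, hω, one_mul]) hz hN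
    fun v hv ↦ ?_
  have h1 : ∀ i, 1 - c * ω i * v = 1 - ω i * (c * v) := fun i ↦ by ring
  simp_rw [h1, hprod]
  calc 1 - q ^ N ≤ ‖(1 : ℂ)‖ - ‖(c * v) ^ N‖ := by
        rw [norm_one, norm_pow, norm_mul, hc, one_mul]
        gcongr
    _ ≤ ‖1 - (c * v) ^ N‖ := norm_sub_norm_le _ _

/-- Area contraction for harmonic maps into the unit disk that are continuous up to the boundary. -/
theorem volume_image_closedBall_le {h g : ℂ → ℂ} (hh : DiffContOnCl ℂ h (ball 0 1))
    (hg : DiffContOnCl ℂ g (ball 0 1))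
    (hfb : ∀ ζ ∈ sphere (0 : ℂ) 1, ‖h ζ + (starRingEnd ℂ) (g ζ)‖ ≤ 1)
    {q : ℝ} (hq0 : 0 < q) (hq1 : q < 1) :
    volume ((fun z ↦ h z + (starRingEnd ℂ) (g z)) '' closedBall 0 q) ≤
      ENNReal.ofReal (Real.pi * q ^ 2) := by
  set K := (fun z ↦ h z + (starRingEnd ℂ) (g z)) '' closedBall 0 q with hKdef
  have hsub : closedBall (0 : ℂ) q ⊆ closure (ball 0 1) := by
    rw [closure_ball _ one_ne_zero]
    exact closedBall_subset_closedBall hq1.le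
  have hK : IsCompact K := (isCompact_closedBall _ _).image_of_continuousOn
    ((hh.continuousOn.mono hsub).add
      (continuous_conj.comp_continuousOn (hg.continuousOn.mono hsub)))
  set C := -((1 - q ^ 2) / q * Real.log (1 - q)) with hC
  have hq2 : 0 < (1 - q ^ 2) / q := div_pos (by nlinarith) hq0
  have hC0 : 0 ≤ C := by
    have := Real.log_nonpos (x := 1 - q) (by linarith) (by linarith)
    nlinarith
  have hbound : ∀ k : ℕ, volume K ≤ ENNReal.ofReal (Real.pi * (q + C / 2 ^ k) ^ 2) := by
    intro k
    obtain ⟨S, hS, hvol, hrep⟩ := exists_isCompact_sum_rotations hK k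
    have hSsub : S ⊆ closedBall 0 (2 ^ k * (q + C / 2 ^ k)) := by
      intro y hy
      obtain ⟨ι, _, ω, x, hcard, hω, hx, rfl, hprod⟩ := hrep y hy
      rw [mem_closedBall_zero_iff]
      refine (norm_sum_mul_harmonic_le hh hg hfb hq0 hq1 hω hx (by positivity) hprod).trans ?_
      have hlog : Real.log (1 - q) ≤ Real.log (1 - q ^ 2 ^ k) := by
        refine Real.log_le_log (by linarith) ?_
        have := pow_le_of_le_one hq0.le hq1.le (n := 2 ^ k) (by positivity)
        linarith
      have h1 := mul_le_mul_of_nonneg_left hlog hq2.le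
      rw [mul_add, mul_div_cancel₀ _ (by positivity), hcard]
      push_cast
      linarith
    have h2 := hvol.trans (measure_mono hSsub)
    have h3 : volume (closedBall (0 : ℂ) (2 ^ k * (q + C / 2 ^ k))) =
        4 ^ k * ENNReal.ofReal (Real.pi * (q + C / 2 ^ k) ^ 2) := by
      rw [Complex.volume_closedBall, ← ENNReal.ofReal_pow (by positivity), mul_pow,
        ENNReal.ofReal_mul (by positivity), ENNReal.ofReal_mul (by positivity), ← pow_mul,
        mul_comm k 2, pow_mul, ENNReal.ofReal_pow (by positivity)]
      norm_num
      rw [mul_assoc]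
      congr 1
      rw [mul_comm, ← NNReal.coe_real_pi, ENNReal.ofReal_coe_nnreal]
    rw [h3] at h2
    exact (ENNReal.mul_le_mul_iff_right (by positivity) (by finiteness)).1 h2
  have hlim : Filter.Tendsto (fun k : ℕ ↦ Real.pi * (q + C / 2 ^ k) ^ 2) Filter.atTop
      (nhds (Real.pi * (q + 0) ^ 2)) :=
    ((tendsto_const_nhds.add (tendsto_const_nhds.div_atTop
      (tendsto_pow_atTop_atTop_of_one_lt one_lt_two))).pow 2).const_mul _
  rw [add_zero] at hlim
  exact ge_of_tendsto' (ENNReal.tendsto_ofReal hlim) hbound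

end

/-- A sense-preserving univalent harmonic self-mapping of the unit
disk satisfies `m(f(r𝔻)) ≤ π r²` for every `0 < r < 1`. -/
theorem area_contraction_disks
    (h g : ℂ → ℂ)
    (hh : DifferentiableOn ℂ h (ball (0 : ℂ) 1))
    (hg : DifferentiableOn ℂ g (ball (0 : ℂ) 1))
    (f : ℂ → ℂ) (hf : f = fun z => h z + (starRingEnd ℂ) (g z))
    (hinj : Set.InjOn f (ball (0 : ℂ) 1))
    (hself : Set.MapsTo f (ball (0 : ℂ) 1) (ball (0 : ℂ) 1))
    (hsp : ∀ z ∈ ball (0 : ℂ) 1, ‖deriv g z‖ < ‖deriv h z‖)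
    (r : ℝ) (hr0 : 0 < r) (hr1 : r < 1) :
    volume (f '' ball (0 : ℂ) r) ≤ ENNReal.ofReal (Real.pi * r ^ 2) := by
  have hR : ∀ R ∈ Set.Ioo r 1,
      volume (f '' ball (0 : ℂ) r) ≤ ENNReal.ofReal (Real.pi * (r / R) ^ 2) := by
    rintro R ⟨hrR, hR1⟩
    have hR0 : 0 < R := hr0.trans hrR
    have hmaps : Set.MapsTo (fun z : ℂ ↦ R * z) (closedBall 0 1) (ball 0 1) := by
      intro z hz
      rw [mem_closedBall_zero_iff] at hz
      rw [mem_ball_zero_iff, norm_mul, Complex.norm_real, Real.norm_of_nonneg hR0.le]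
      nlinarith
    have hdil : ∀ F : ℂ → ℂ, DifferentiableOn ℂ F (ball 0 1) →
        DiffContOnCl ℂ (fun z ↦ F (R * z)) (ball 0 1) := by
      intro F hF
      have : DifferentiableOn ℂ (fun z ↦ F (R * z)) (closedBall 0 1) :=
        hF.comp (by fun_prop) hmaps
      refine DifferentiableOn.diffContOnCl ?_
      rwa [closure_ball _ one_ne_zero]
    refine (measure_mono ?_).trans (volume_image_closedBall_le (hdil h hh) (hdil g hg) ?_
      (div_pos hr0 hR0) ((div_lt_one hR0).2 hrR))
    · rintro _ ⟨z, hz, rfl⟩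
      have hR0' : (R : ℂ) ≠ 0 := Complex.ofReal_ne_zero.2 hR0.ne'
      refine ⟨z / R, ?_, by simp only [hf, mul_div_cancel₀ z hR0']⟩
      rw [mem_closedBall_zero_iff, norm_div, Complex.norm_real, Real.norm_of_nonneg hR0.le]
      gcongr
      exact (mem_ball_zero_iff.1 hz).le
    · intro ζ hζ
      have h1 := mem_ball_zero_iff.1 (hself (hmaps (sphere_subset_closedBall hζ)))
      rw [hf] at h1
      exact h1.le
  have hlim : Filter.Tendsto (fun R : ℝ ↦ Real.pi * (r / R) ^ 2) (nhdsWithin 1 (Set.Iio 1))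
      (nhds (Real.pi * (r / 1) ^ 2)) := by
    refine Filter.Tendsto.mono_left ?_ nhdsWithin_le_nhds
    exact ((tendsto_const_nhds.div Filter.tendsto_id one_ne_zero).pow 2).const_mul _
  rw [div_one] at hlim
  refine ge_of_tendsto (ENNReal.tendsto_ofReal hlim) ?_
  filter_upwards [Ioo_mem_nhdsLT hr1] with R hRr using hR R hRr
end

section
/- Let f = h + conj(g) be a sense-preserving univalent harmonic self-mapping of the unit disk 𝔻 satisfying the pointwise Jacobian bound J_f(z) ≤ (1 − |f(z)|²)²/(1 − |z|²)² for all z ∈ 𝔻, where J_f(z) = |h'(z)|² − |g'(z)|². Then for every r with 0 < r < 1, m(f(r𝔻)) ≤ π r², where r𝔻 = {z ∈ ℂ : |z| < r}. -/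
open MeasureTheory Metric Complex

/-- The real determinant of `z ↦ a z + conj (b z)` is `|a|² - |b|²`. -/
theorem det_smul_add_conj_smul (a b : ℂ) :
    (a • (ContinuousLinearMap.id ℝ ℂ) +
      (conjCLE : ℂ →L[ℝ] ℂ).comp (b • (ContinuousLinearMap.id ℝ ℂ))).det
      = ‖a‖ ^ 2 - ‖b‖ ^ 2 := by
  rw [ContinuousLinearMap.det, ← LinearMap.det_toMatrix basisOneI, Matrix.det_fin_two]
  simp only [LinearMap.toMatrix_apply, ← normSq_eq_norm_sq, normSq_apply]
  simp
  ring

/-- The real Fréchet derivative of a harmonic map `h + conj g`. -/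
theorem hasFDerivAt_add_conj {h g : ℂ → ℂ} {a b z : ℂ} (hh : HasDerivAt h a z)
    (hg : HasDerivAt g b z) :
    HasFDerivAt (fun z => h z + (starRingEnd ℂ) (g z))
      (a • (ContinuousLinearMap.id ℝ ℂ) +
        (conjCLE : ℂ →L[ℝ] ℂ).comp (b • (ContinuousLinearMap.id ℝ ℂ))) z := by
  have h1 := hh.complexToReal_fderiv
  have h2 := (conjCLE : ℂ →L[ℝ] ℂ).hasFDerivAt.comp z hg.complexToReal_fderiv
  exact h1.add h2

/-- **Bathtub principle**: if a density is at most `c` on `D` and at least `c` on `Ω \ D`, and `Ω`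
has no more weighted measure than `D`, then `Ω` has no more measure than `D`. -/
theorem measure_le_of_setLIntegral_le {α : Type*} [MeasurableSpace α] {μ : Measure α}
    {D Ω : Set α} (hD : MeasurableSet D) (hΩ : MeasurableSet Ω) {ρ : α → ENNReal} {c : ENNReal}
    (hc0 : c ≠ 0) (hc : c ≠ ⊤) (hDfin : μ D ≠ ⊤)
    (hle : ∀ x ∈ D, ρ x ≤ c) (hge : ∀ x ∈ Ω \ D, c ≤ ρ x)
    (hint : ∫⁻ x in Ω, ρ x ∂μ ≤ ∫⁻ x in D, ρ x ∂μ) : μ Ω ≤ μ D := by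
  have upper : ∀ s ⊆ D, MeasurableSet s → ∫⁻ x in s, ρ x ∂μ ≤ c * μ s := fun s hs hm =>
    (setLIntegral_mono' hm fun x hx => hle x (hs hx)).trans_eq (setLIntegral_const s c)
  have lower : c * μ (Ω \ D) ≤ ∫⁻ x in Ω \ D, ρ x ∂μ :=
    (setLIntegral_const _ c).symm.trans_le (setLIntegral_mono' (hΩ.diff hD) hge)
  have hfin : ∫⁻ x in D ∩ Ω, ρ x ∂μ ≠ ⊤ :=
    ne_top_of_le_ne_top (ENNReal.mul_ne_top hc hDfin)
      ((upper _ Set.inter_subset_left (hD.inter hΩ)).trans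
        (by gcongr; exact Set.inter_subset_left))
  rw [← lintegral_inter_add_sdiff ρ Ω hD, ← lintegral_inter_add_sdiff ρ D hΩ,
    Set.inter_comm Ω D, ENNReal.add_le_add_iff_left hfin] at hint
  have key : μ (Ω \ D) ≤ μ (D \ Ω) :=
    (ENNReal.mul_le_mul_iff_right hc0 hc).1
      (lower.trans (hint.trans (upper _ Set.sdiff_subset (hD.diff hΩ))))
  rw [← measure_inter_add_sdiff Ω hD, ← measure_inter_add_sdiff D hΩ, Set.inter_comm Ω D]
  gcongr

/-- If a sense-preserving univalent harmonic self-mapping of the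
unit disk satisfies the pointwise Schwarz–Pick type Jacobian bound
`J_f(z) ≤ (1 - |f(z)|²)²/(1 - |z|²)²`, then `m(f(r𝔻)) ≤ π r²` for `0 < r < 1`. -/
theorem pointwise_bound_implies_area_bound
    (h g : ℂ → ℂ)
    (hh : DifferentiableOn ℂ h (ball (0 : ℂ) 1))
    (hg : DifferentiableOn ℂ g (ball (0 : ℂ) 1))
    (f : ℂ → ℂ) (hf : f = fun z => h z + (starRingEnd ℂ) (g z))
    (hinj : Set.InjOn f (ball (0 : ℂ) 1))
    (hself : Set.MapsTo f (ball (0 : ℂ) 1) (ball (0 : ℂ) 1))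
    (hsp : ∀ z ∈ ball (0 : ℂ) 1, ‖deriv g z‖ < ‖deriv h z‖)
    (hSP : ∀ z ∈ ball (0 : ℂ) 1,
      ‖deriv h z‖ ^ 2 - ‖deriv g z‖ ^ 2
        ≤ (1 - ‖f z‖ ^ 2) ^ 2 / (1 - ‖z‖ ^ 2) ^ 2)
    (r : ℝ) (hr0 : 0 < r) (hr1 : r < 1) :
    volume (f '' ball (0 : ℂ) r) ≤ ENNReal.ofReal (Real.pi * r ^ 2) := by
  have hsub : ball (0 : ℂ) r ⊆ ball 0 1 := ball_subset_ball hr1.le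
  have hderiv : ∀ z ∈ ball (0 : ℂ) r, HasFDerivWithinAt f
      (deriv h z • (ContinuousLinearMap.id ℝ ℂ) +
        (conjCLE : ℂ →L[ℝ] ℂ).comp (deriv g z • (ContinuousLinearMap.id ℝ ℂ)))
      (ball (0 : ℂ) r) z := by
    intro z hz
    have hnhds : ball (0 : ℂ) 1 ∈ nhds z := isOpen_ball.mem_nhds (hsub hz)
    rw [hf]
    exact (hasFDerivAt_add_conj (hh.differentiableAt hnhds).hasDerivAt
      (hg.differentiableAt hnhds).hasDerivAt).hasFDerivWithinAt
  have hinj' := hinj.mono hsub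
  have hpos : ∀ z ∈ ball (0 : ℂ) 1, 0 < 1 - ‖z‖ ^ 2 := by
    intro z hz
    have : ‖z‖ < 1 := mem_ball_zero_iff.1 hz
    nlinarith [norm_nonneg z]
  have hrpos : 0 < 1 - r ^ 2 := by nlinarith
  have harea : volume (ball (0 : ℂ) r) = ENNReal.ofReal (Real.pi * r ^ 2) := by
    rw [Complex.volume_ball, mul_comm Real.pi, ENNReal.ofReal_mul (by positivity),
      ENNReal.ofReal_pow hr0.le, ← NNReal.coe_real_pi, ENNReal.ofReal_coe_nnreal]
  rw [← harea]
  refine measure_le_of_setLIntegral_le (c := ENNReal.ofReal (1 / (1 - r ^ 2) ^ 2))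
    (ρ := fun w => ENNReal.ofReal (1 / (1 - ‖w‖ ^ 2) ^ 2)) measurableSet_ball
    (measurable_image_of_fderivWithin measurableSet_ball hderiv hinj') ?_
    ENNReal.ofReal_ne_top measure_ball_lt_top.ne ?_ ?_ ?_
  · rw [ne_eq, ENNReal.ofReal_eq_zero, not_le]
    positivity
  · intro z hz
    have : ‖z‖ < r := mem_ball_zero_iff.1 hz
    gcongr
  · rintro w ⟨⟨z, hz, rfl⟩, hw⟩
    have hw' : r ≤ ‖f z‖ := by simpa using hw
    have := hpos _ (hself (hsub hz))
    gcongr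
  · rw [lintegral_image_eq_lintegral_abs_det_fderiv_mul volume measurableSet_ball hderiv hinj']
    refine setLIntegral_mono' measurableSet_ball fun z hz => ?_
    have hz1 := hsub hz
    have hjac : 0 ≤ ‖deriv h z‖ ^ 2 - ‖deriv g z‖ ^ 2 := by
      have := hsp z hz1
      nlinarith [norm_nonneg (deriv g z)]
    have hfz := hpos _ (hself hz1)
    rw [det_smul_add_conj_smul, abs_of_nonneg hjac, ← ENNReal.ofReal_mul hjac]
    refine ENNReal.ofReal_le_ofReal ?_
    calc _ ≤ (1 - ‖f z‖ ^ 2) ^ 2 / (1 - ‖z‖ ^ 2) ^ 2 * (1 / (1 - ‖f z‖ ^ 2) ^ 2) := by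
          gcongr
          exact hSP z hz1
      _ = 1 / (1 - ‖z‖ ^ 2) ^ 2 := by field_simp
end
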